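/- Let L = A ⊕ B as Lie algebras forming a matched pair (A and B are Lie subalgebras of L with L = A ⊕ B as modules). Then for ξ_1, ξ_2 ∈ Λ^• A^∨, b_1, b_2 ∈ B, the bracket [ξ_1 ⊗ b_1, ξ_2 ⊗ b_2] = ξ_1 ∧ ξ_2 ⊗ [b_1,b_2] + ξ_1 ∧ (∇^Bott_{b_1} ξ_2) ⊗ b_2 − (∇^Bott_{b_2} ξ_1) ∧ ξ_2 ⊗ b_1, together with the anchor ρ̄(ξ ⊗ b)(η) = ξ ∧ ∇^Bott_b η, defines a graded Lie algebra structure on Λ^• A^∨ ⊗ B over the graded commutative algebra Λ^• A^∨; in particular the bracket satisfies the graded Jacobi identity and the graded Leibniz rule with respect to ρ̄. -/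

import Mathlib

noncomputable section

variable {K L : Type*} [Field K] [CharZero K] [LieRing L] [LieAlgebra K L]

/-- Bott-type action: for `b ∈ B` and `a ∈ A`, `∇^Bott_b a = pr_A ⁅b, a⁆`. -/
def bott (A B : Submodule K L) (hc : IsCompl A B) (b : ↥B) (a : ↥A) : ↥A :=
  A.linearProjOfIsCompl B hc ⁅(b : L), (a : L)⁆

/-- The `(p,q)`-unshuffles of `Fin (p+q)`. -/
def unshuffles (p q : ℕ) : Finset (Equiv.Perm (Fin (p + q))) :=
  Finset.univ.filter (fun σ : Equiv.Perm (Fin (p + q)) =>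
    ∀ i j : Fin (p + q), i < j → ((j : ℕ) < p ∨ p ≤ (i : ℕ)) → σ i < σ j)

/-- The graded bracket on `Λ^• A^∨ ⊗ B`, modelled on `B`-valued alternating cochains on
`A`; on decomposable elements it is the three-term formula of the statement. -/
def brC (A B : Submodule K L) (hc : IsCompl A B)
    (hB : ∀ x y : L, x ∈ B → y ∈ B → ⁅x, y⁆ ∈ B)
    (p q : ℕ) (φ : (Fin p → ↥A) → ↥B) (ψ : (Fin q → ↥A) → ↥B) :
    (Fin (p + q) → ↥A) → ↥B :=
  fun x =>
    (∑ σ ∈ unshuffles p q, ((Equiv.Perm.sign σ : ℤ)) •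
      (let u := φ (fun i : Fin p => x (σ ⟨i.1, by have := i.2; omega⟩))
       let v := ψ (fun i : Fin q => x (σ ⟨p + i.1, by have := i.2; omega⟩))
       (⟨⁅(u : L), (v : L)⁆, hB _ _ u.2 v.2⟩ : ↥B)))
    - ∑ σ ∈ unshuffles p q, ((Equiv.Perm.sign σ : ℤ)) •
        ∑ i : Fin q,
          ψ (Function.update
              (fun i' : Fin q => x (σ ⟨p + i'.1, by have := i'.2; omega⟩)) i
              (bott A B hc (φ (fun i' : Fin p => x (σ ⟨i'.1, by have := i'.2; omega⟩)))
                (x (σ ⟨p + i.1, by have := i.2; omega⟩))))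
    + ((-1 : ℤ) ^ (p * q)) •
      ∑ σ ∈ unshuffles q p, ((Equiv.Perm.sign σ : ℤ)) •
        ∑ i : Fin p,
          φ (Function.update
              (fun i' : Fin p =>
                x (Fin.cast (by omega) (σ ⟨q + i'.1, by have := i'.2; omega⟩))) i
              (bott A B hc
                (ψ (fun i' : Fin q =>
                  x (Fin.cast (by omega) (σ ⟨i'.1, by have := i'.2; omega⟩))))
                (x (Fin.cast (by omega) (σ ⟨q + i.1, by have := i.2; omega⟩)))))

/-- The wedge product of scalar cochains. -/
def wK (p q : ℕ) {A : Submodule K L}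
    (c : (Fin p → ↥A) → K) (c' : (Fin q → ↥A) → K) : (Fin (p + q) → ↥A) → K :=
  fun x =>
    ∑ σ ∈ unshuffles p q, ((Equiv.Perm.sign σ : ℤ)) •
      (c (fun i : Fin p => x (σ ⟨i.1, by have := i.2; omega⟩)) *
        c' (fun i : Fin q => x (σ ⟨p + i.1, by have := i.2; omega⟩)))

/-- The wedge of a scalar cochain with a `B`-valued cochain (the module structure over
`Λ^• A^∨`). -/
def wmul {A B : Submodule K L} (t q : ℕ)
    (gg : (Fin t → ↥A) → K) (ψ : (Fin q → ↥A) → ↥B) : (Fin (t + q) → ↥A) → ↥B :=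
  fun x =>
    ∑ σ ∈ unshuffles t q, ((Equiv.Perm.sign σ : ℤ)) •
      (gg (fun i : Fin t => x (σ ⟨i.1, by have := i.2; omega⟩)) •
        ψ (fun i : Fin q => x (σ ⟨t + i.1, by have := i.2; omega⟩)))

/-- The anchor `ρ̄(φ)` applied to a scalar cochain; for decomposables
`ρ̄(ξ⊗b)(η) = ξ ∧ ∇^Bott_b η`. -/
def anchorAct (A B : Submodule K L) (hc : IsCompl A B) (p t : ℕ)
    (φ : (Fin p → ↥A) → ↥B) (gg : (Fin t → ↥A) → K) : (Fin (p + t) → ↥A) → K :=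
  fun x =>
    - ∑ σ ∈ unshuffles p t, ((Equiv.Perm.sign σ : ℤ)) •
        ∑ i : Fin t,
          gg (Function.update
              (fun i' : Fin t => x (σ ⟨p + i'.1, by have := i'.2; omega⟩)) i
              (bott A B hc (φ (fun i' : Fin p => x (σ ⟨i'.1, by have := i'.2; omega⟩)))
                (x (σ ⟨p + i.1, by have := i.2; omega⟩))))

/-- The Bott action of `b ∈ B` on scalar cochains:
`(∇^Bott_b η)(a_1,…,a_q) = −Σ_i η(a_1, …, pr_A⁅b, a_i⁆, …, a_q)`. -/
def bottForm (A B : Submodule K L) (hc : IsCompl A B) (q : ℕ) (b : ↥B)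
    (η : (Fin q → ↥A) → K) : (Fin q → ↥A) → K :=
  fun z => - ∑ i : Fin q, η (Function.update z i (bott A B hc b (z i)))

section AlternatingSums

open Equiv Equiv.Perm

/-- The full antisymmetrization of `k` over the permutations of the index type, without
normalization. -/
def altSum {ι X V : Type*} [Fintype ι] [DecidableEq ι] [AddCommGroup V]
    (k : (ι → X) → V) (x : ι → X) : V :=
  ∑ σ : Perm ι, (sign σ : ℤ) • k (fun i => x (σ i))

/-- A function of `ι`-tuples that changes by the sign under permutations of its arguments. -/
def IsSkew {ι X V : Type*} [Fintype ι] [DecidableEq ι] [AddCommGroup V]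
    (F : (ι → X) → V) : Prop :=
  ∀ (σ : Perm ι) (x : ι → X), F (fun i => x (σ i)) = (sign σ : ℤ) • F x

/-- A function of `ι ⊕ κ`-tuples that is skew in each of the two blocks of arguments. -/
def IsBlockSkew {ι κ X V : Type*} [Fintype ι] [DecidableEq ι] [Fintype κ] [DecidableEq κ]
    [AddCommGroup V] (k : (ι ⊕ κ → X) → V) : Prop :=
  ∀ (σ : Perm ι) (τ : Perm κ) (z : ι ⊕ κ → X),
    k (fun i => z (Perm.sumCongr σ τ i)) = ((sign σ : ℤ) * (sign τ : ℤ)) • k z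

variable {ι ι' κ κ' X V W : Type*} [Fintype ι] [DecidableEq ι] [Fintype ι'] [DecidableEq ι']
  [Fintype κ] [DecidableEq κ] [Fintype κ'] [DecidableEq κ'] [AddCommGroup V] [AddCommGroup W]

lemma sign_smul_sign_smul (σ : Perm ι) (v : V) : (sign σ : ℤ) • (sign σ : ℤ) • v = v := by
  rw [smul_smul, ← Units.val_mul, Int.units_mul_self, Units.val_one, one_smul]

lemma AlternatingMap.isSkew {R M N : Type*} [Ring R] [AddCommGroup M] [Module R M]
    [AddCommGroup N] [Module R N] (f : AlternatingMap R M N ι) : IsSkew ⇑f := by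
  intro σ x
  have h := f.map_perm x σ
  rw [Units.smul_def] at h
  exact h

lemma altSum_isSkew (k : (ι → X) → V) : IsSkew (altSum k) := by
  intro σ x
  unfold altSum
  rw [Finset.smul_sum]
  refine Fintype.sum_equiv (Equiv.mulLeft σ) _ _ fun τ => ?_
  rw [Equiv.coe_mulLeft, Perm.sign_mul, Units.val_mul, mul_smul, sign_smul_sign_smul]
  rfl

/-- Antisymmetrizations over two index types that parametrize the same tuple differ by the sign
of the induced permutation. -/
lemma altSum_reindex (e : ι ≃ κ) (e' : ι' ≃ κ) (r : ι' ≃ ι) (k : (ι' → X) → V) (x : κ → X) :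
    altSum k (fun i => x (e' i)) =
      (sign (e.symm.trans (r.symm.trans e')) : ℤ) •
        altSum (fun z => k (fun i => z (r i))) (fun i => x (e i)) := by
  have hs : sign (e.symm.trans (r.symm.trans e')) = sign (r.trans (e.trans e'.symm)) := by
    rw [← sign_symm, ← sign_permCongr e'.symm]
    congr 1
    ext i
    simp [Equiv.permCongr_apply]
  rw [hs]
  unfold altSum
  rw [Finset.smul_sum]
  refine (Fintype.sum_equiv
    (r.permCongr.symm.trans (Equiv.mulLeft (r.trans (e.trans e'.symm)))) _ _
    fun σ => ?_).symm
  simp [smul_smul]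

lemma altSum_sum {α : Type*} (s : Finset α) (k : α → (ι → X) → V) (x : ι → X) :
    altSum (fun z => ∑ a ∈ s, k a z) x = ∑ a ∈ s, altSum (k a) x := by
  unfold altSum
  simp_rw [Finset.smul_sum]
  exact Finset.sum_comm

lemma altSum_add (k l : (ι → X) → V) (x : ι → X) :
    altSum (fun z => k z + l z) x = altSum k x + altSum l x := by
  simp [altSum, Finset.sum_add_distrib]

lemma altSum_neg (k : (ι → X) → V) (x : ι → X) :
    altSum (fun z => -k z) x = -altSum k x := by
  simp [altSum]

lemma altSum_sub (k l : (ι → X) → V) (x : ι → X) :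
    altSum (fun z => k z - l z) x = altSum k x - altSum l x := by
  simp [altSum, smul_sub]

lemma altSum_zsmul (c : ℤ) (k : (ι → X) → V) (x : ι → X) :
    altSum (fun z => c • k z) x = c • altSum k x := by
  unfold altSum
  rw [Finset.smul_sum]
  exact Finset.sum_congr rfl fun σ _ => smul_comm _ _ _

lemma altSum_nsmul (c : ℕ) (k : (ι → X) → V) (x : ι → X) :
    altSum (fun z => c • k z) x = c • altSum k x := by
  simpa only [natCast_zsmul] using altSum_zsmul (c : ℤ) k x

/-- If a multiple of `Φ` is an antisymmetrization and `Op` is additive and compatible with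
reindexing, then the antisymmetrization inside `Op` is absorbed by the outer one. -/
lemma altSum_absorb {α : Type*} (Op : ((α → X) → V) →+ ((ι' → X) → W)) (f : (κ → X) → V)
    (G : (κ' → X) → W) (e : κ ≃ α) (e' : κ' ≃ ι') (s : Perm κ → Perm κ')
    (hs : ∀ σ, sign (s σ) = sign σ)
    (hOp : ∀ (σ : Perm κ) (z : ι' → X),
      Op (fun y => f (fun i => y (e (σ i)))) z = G (fun i => z (e' (s σ i))))
    (c : ℕ) (Φ : (α → X) → V) (hΦ : ∀ y, c • Φ y = altSum f (fun i => y (e i))) (x : ι' → X) :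
    c • altSum (Op Φ) x = (Fintype.card κ).factorial • altSum G (fun i => x (e' i)) := by
  have h1 : c • Φ = ∑ σ : Perm κ, (sign σ : ℤ) • fun y : α → X => f (fun i => y (e (σ i))) := by
    funext y
    rw [Pi.smul_apply, hΦ]
    simp [altSum]
  have h2 : ∀ z, c • Op Φ z = ∑ σ : Perm κ, (sign σ : ℤ) • G (fun i => z (e' (s σ i))) := by
    intro z
    have h3 := congrFun (congrArg Op h1) z
    rw [map_nsmul, map_sum, Finset.sum_apply, Pi.smul_apply] at h3
    rw [h3]
    refine Finset.sum_congr rfl fun σ _ => ?_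
    rw [map_zsmul, Pi.smul_apply, hOp]
  rw [← altSum_nsmul]
  simp_rw [h2]
  rw [altSum_sum]
  have h4 : ∀ σ : Perm κ, altSum (fun z => (sign σ : ℤ) • G (fun i => z (e' (s σ i)))) x =
      altSum G (fun i => x (e' i)) := by
    intro σ
    rw [altSum_zsmul]
    have h5 := altSum_reindex (Equiv.refl ι') ((s σ).trans e') ((s σ).trans e') G x
    simp only [Equiv.refl_symm, Equiv.refl_trans, Equiv.symm_trans_self, sign_refl, Units.val_one,
      one_smul, Equiv.refl_apply, Equiv.trans_apply] at h5
    rw [← h5, ← hs, altSum_isSkew G (s σ) (fun i => x (e' i)), sign_smul_sign_smul]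
  simp_rw [h4]
  rw [Finset.sum_const, Finset.card_univ, Fintype.card_perm]

lemma IsSkew.of_nsmul [IsAddTorsionFree V] {F : (ι → X) → V} {f : (κ → X) → V} (e : κ ≃ ι)
    {c : ℕ} (hc : c ≠ 0) (h : ∀ y, c • F y = altSum f (fun i => y (e i))) : IsSkew F := by
  intro σ x
  refine nsmul_right_injective hc ?_
  have h1 := altSum_isSkew f ((e.symm.permCongr σ)) (fun i => x (e i))
  simp only [Equiv.permCongr_apply, Equiv.symm_symm, Equiv.apply_symm_apply] at h1
  simp only
  rw [h, smul_comm, h, h1, ← sign_permCongr e.symm σ]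

end AlternatingSums

section Unshuffles

open Equiv Equiv.Perm

lemma existsUnique_strictMono_comp_perm {α : Type*} [LinearOrder α] {n : ℕ} (f : Fin n → α)
    (hf : Function.Injective f) : ∃! τ : Perm (Fin n), StrictMono (f ∘ τ) := by
  refine ⟨Tuple.sort f,
    (Tuple.monotone_sort f).strictMono_of_injective (hf.comp (Equiv.injective _)), fun τ hτ => ?_⟩
  have h := Tuple.unique_monotone hτ.monotone (Tuple.monotone_sort f)
  ext i
  exact congrArg Fin.val (hf (congrFun h i))

lemma mem_unshuffles_iff {p q : ℕ} (σ : Perm (Fin (p + q))) :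
    σ ∈ unshuffles p q ↔ StrictMono (fun i : Fin p => σ (Fin.castAdd q i)) ∧
      StrictMono (fun i : Fin q => σ (Fin.natAdd p i)) := by
  unfold unshuffles
  rw [Finset.mem_filter]
  constructor
  · rintro ⟨-, h⟩
    refine ⟨fun i j hij => h _ _ hij (Or.inl ?_), fun i j hij => h _ _ ?_ (Or.inr ?_)⟩
    · simp
    · exact (Fin.natAdd_lt_natAdd_iff p).2 hij
    · simp
  · rintro ⟨h1, h2⟩
    refine ⟨Finset.mem_univ _, fun i j hij h => ?_⟩
    induction i using Fin.addCases with
    | left i =>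
      induction j using Fin.addCases with
      | left j => exact h1 hij
      | right j => simp at h; omega
    | right i =>
      induction j using Fin.addCases with
      | left j => simp [Fin.lt_def] at hij; omega
      | right j => exact h2 ((Fin.natAdd_lt_natAdd_iff p).1 hij)

/-- The permutation of `Fin (p + q)` acting by `τ.1` on the first block and by `τ.2` on the
second one. -/
def blockPerm (p q : ℕ) (τ : Perm (Fin p) × Perm (Fin q)) : Perm (Fin (p + q)) :=
  finSumFinEquiv.permCongr (Perm.sumCongr τ.1 τ.2)

lemma existsUnique_mul_blockPerm_mem_unshuffles (p q : ℕ) (σ : Perm (Fin (p + q))) :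
    ∃! τ : Perm (Fin p) × Perm (Fin q), σ * blockPerm p q τ ∈ unshuffles p q := by
  have h1 := existsUnique_strictMono_comp_perm (fun i : Fin p => σ (Fin.castAdd q i))
    (σ.injective.comp (Fin.castAdd_injective p q))
  have h2 := existsUnique_strictMono_comp_perm (fun i : Fin q => σ (Fin.natAdd p i))
    (σ.injective.comp (Fin.natAdd_injective q p))
  have key : ∀ τ : Perm (Fin p) × Perm (Fin q), σ * blockPerm p q τ ∈ unshuffles p q ↔
      StrictMono ((fun i : Fin p => σ (Fin.castAdd q i)) ∘ τ.1) ∧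
      StrictMono ((fun i : Fin q => σ (Fin.natAdd p i)) ∘ τ.2) := by
    intro τ
    rw [mem_unshuffles_iff]
    simp [blockPerm, Equiv.permCongr_apply, Function.comp_def]
  obtain ⟨τ₁, h11, h12⟩ := h1
  obtain ⟨τ₂, h21, h22⟩ := h2
  exact ⟨(τ₁, τ₂), (key _).2 ⟨h11, h21⟩, fun τ hτ =>
    Prod.ext (h12 _ ((key τ).1 hτ).1) (h22 _ ((key τ).1 hτ).2)⟩

variable {X V : Type*} [AddCommGroup V]

/-- For a block-skew kernel the sum over unshuffles is, up to the factor `p! q!`, the full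
antisymmetrization. -/
lemma factorial_smul_sum_unshuffles (p q : ℕ) (k : (Fin p ⊕ Fin q → X) → V) (hk : IsBlockSkew k)
    (x : Fin (p + q) → X) :
    (p.factorial * q.factorial) •
        ∑ σ ∈ unshuffles p q, (sign σ : ℤ) • k (fun i => x (σ (finSumFinEquiv i))) =
      altSum k (fun i => x (finSumFinEquiv i)) := by
  classical
  set g : Perm (Fin (p + q)) → V :=
    fun σ => (sign σ : ℤ) • k (fun i => x (σ (finSumFinEquiv i))) with hg
  have hinv : ∀ σ τ, g (σ * blockPerm p q τ) = g σ := by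
    intro σ τ
    have h := hk τ.1 τ.2 (fun i => x (σ (finSumFinEquiv i)))
    have hs : sign (blockPerm p q τ) = sign τ.1 * sign τ.2 := by
      rw [blockPerm, sign_permCongr, sign_sumCongr]
    have hb : ∀ i, blockPerm p q τ (finSumFinEquiv i) = finSumFinEquiv (Perm.sumCongr τ.1 τ.2 i) := by
      intro i
      simp [blockPerm, Equiv.permCongr_apply]
    simp only [hg, Perm.mul_apply, hb]
    rw [h, Perm.sign_mul, hs, Units.val_mul, Units.val_mul, smul_smul, mul_assoc,
      ← Units.val_mul (sign τ.1), ← Units.val_mul, Int.units_mul_self, Units.val_one, mul_one]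
  have hcard : (p.factorial * q.factorial) =
      (Finset.univ : Finset (Perm (Fin p) × Perm (Fin q))).card := by
    rw [Finset.card_univ, Fintype.card_prod, Fintype.card_perm, Fintype.card_perm,
      Fintype.card_fin, Fintype.card_fin]
  have h1 : altSum k (fun i => x (finSumFinEquiv i)) = ∑ σ, g σ := by
    refine Fintype.sum_equiv finSumFinEquiv.permCongr _ _ fun σ => ?_
    have h2 : ∀ i, finSumFinEquiv.permCongr σ (finSumFinEquiv i) = finSumFinEquiv (σ i) := by
      intro i
      simp [Equiv.permCongr_apply]
    simp only [hg, h2, sign_permCongr]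
  have h3 : ∀ τ, ∑ σ ∈ unshuffles p q, g σ =
      ∑ σ, if σ * blockPerm p q τ ∈ unshuffles p q then g σ else 0 := by
    intro τ
    have h4 : ∑ σ ∈ unshuffles p q, g σ = ∑ σ, if σ ∈ unshuffles p q then g σ else 0 := by
      rw [Finset.sum_ite_mem, Finset.univ_inter]
    rw [h4]
    refine (Fintype.sum_equiv (Equiv.mulRight (blockPerm p q τ)) _ _ fun σ => ?_).symm
    simp [hinv]
  rw [h1, hcard, ← Finset.sum_const, Finset.sum_congr rfl fun τ _ => h3 τ, Finset.sum_comm]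
  refine Finset.sum_congr rfl fun σ _ => ?_
  obtain ⟨τ₀, h0, hu⟩ := existsUnique_mul_blockPerm_mem_unshuffles p q σ
  rw [Finset.sum_eq_single τ₀, if_pos h0]
  · exact fun τ _ hτ => if_neg fun h => hτ (hu τ h)
  · exact fun h => absurd (Finset.mem_univ _) h

end Unshuffles

section BlockRotation

open Equiv Equiv.Perm

/-- The sign of the permutation exchanging two consecutive blocks of lengths `p` and `m`. -/
lemma sign_eq_of_rotate {N p m : ℕ} (hN : p + m = N) (π : Perm (Fin N))
    (hπ : ∀ i : Fin N, (π i : ℕ) = if (i : ℕ) < p then i + m else i - p) :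
    (sign π : ℤ) = (-1) ^ (p * m) := by
  rcases Nat.eq_zero_or_pos p with rfl | hp
  · have h : π = 1 := by
      ext i
      simp [hπ]
    simp [h]
  · have hm : m < N := by omega
    have : NeZero N := ⟨by omega⟩
    have h : π = finRotate N ^ m := by
      have h1 : π = finCycle (⟨m, hm⟩ : Fin N) := by
        ext i
        have hi := i.2
        rw [hπ, finCycle_apply, Fin.val_add]
        split_ifs with h
        · rw [Nat.mod_eq_of_lt]
          simp only
          omega
        · have h2 : (i : ℕ) + m = (i - p) + N := by omega
          simp only
          rw [h2, Nat.add_mod_right, Nat.mod_eq_of_lt (by omega)]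
      rw [h1]
      ext1 i
      rw [finCycle_eq_finRotate_iterate, ← Perm.coe_pow]
    rw [h, map_pow, sign_finRotate]
    push_cast
    rw [← pow_mul]
    subst hN
    obtain ⟨a, rfl⟩ : ∃ a, p = a + 1 := ⟨p - 1, by omega⟩
    have h3 : (a + 1 + m - 1) * m + 2 * 0 + (m + m) = (a + 1) * m + m * (m + 1) := by
      have h4 : a + 1 + m - 1 = a + m := by omega
      rw [h4]
      ring
    have h5 := congrArg (fun n => (-1 : ℤ) ^ n) h3
    simpa [pow_add, (Nat.even_mul_succ_self m).neg_one_pow, ← mul_pow] using h5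

end BlockRotation

/-- The exchange of the first two of three blocks of indices, associated to the right. -/
def sumLeftComm (ι κ ι' : Type*) : κ ⊕ (ι ⊕ ι') ≃ ι ⊕ (κ ⊕ ι') :=
  (Equiv.sumAssoc κ ι ι').symm.trans
    ((Equiv.sumCongr (Equiv.sumComm κ ι) (Equiv.refl ι')).trans (Equiv.sumAssoc ι κ ι'))

section Derivations

variable {R X Y V W ι κ ι' κ' : Type*} [CommRing R] [AddCommGroup X] [Module R X]
  [AddCommGroup Y] [Module R Y] [AddCommGroup V] [AddCommGroup W]
  [Fintype ι] [DecidableEq ι] [Fintype κ] [DecidableEq κ]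
  [Fintype ι'] [DecidableEq ι'] [Fintype κ'] [DecidableEq κ']

/-- The derivation action of `b` on functions of tuples dual to the action `ρ` on the
arguments. -/
def der (ρ : Y →ₗ[R] X →ₗ[R] X) (b : Y) (F : (ι → X) → V) (z : ι → X) : V :=
  -∑ i, F (Function.update z i (ρ b (z i)))

/-- The derivation action on `F` depends additively on the acting element. -/
def DerAdditive (ρ : Y →ₗ[R] X →ₗ[R] X) (F : (ι → X) → V) : Prop :=
  ∀ (b b' : Y) (z : ι → X), der ρ (b + b') F z = der ρ b F z + der ρ b' F z

variable (ρ : Y →ₗ[R] X →ₗ[R] X)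

/-- The derivation action on `F` at a fixed tuple as an additive map. -/
def DerAdditive.hom {ρ : Y →ₗ[R] X →ₗ[R] X} {F : (ι → X) → V} (hF : DerAdditive ρ F)
    (z : ι → X) : Y →+ V :=
  AddMonoidHom.mk' (fun b => der ρ b F z) fun b b' => hF b b' z

lemma DerAdditive.map_zsmul {ρ : Y →ₗ[R] X →ₗ[R] X} {F : (ι → X) → V} (hF : DerAdditive ρ F)
    (c : ℤ) (b : Y) (z : ι → X) : der ρ (c • b) F z = c • der ρ b F z :=
  _root_.map_zsmul (hF.hom z) c b

lemma der_add (b : Y) (F G : (ι → X) → V) (z : ι → X) :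
    der ρ b (fun y => F y + G y) z = der ρ b F z + der ρ b G z := by
  simp only [der, Finset.sum_add_distrib, neg_add]

lemma der_sub (b : Y) (F G : (ι → X) → V) (z : ι → X) :
    der ρ b (fun y => F y - G y) z = der ρ b F z - der ρ b G z := by
  simp only [der, Finset.sum_sub_distrib]
  abel

lemma der_map (b : Y) (L : V →+ W) (F : (ι → X) → V) (z : ι → X) :
    der ρ b (fun y => L (F y)) z = L (der ρ b F z) := by
  simp only [der, map_neg, map_sum]

lemma der_zsmul (b : Y) (c : ℤ) (F : (ι → X) → V) (z : ι → X) :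
    der ρ b (fun y => c • F y) z = c • der ρ b F z := by
  simp only [der, ← Finset.smul_sum, smul_neg]

lemma der_nsmul (b : Y) (c : ℕ) (F : (ι → X) → V) (z : ι → X) :
    der ρ b (fun y => c • F y) z = c • der ρ b F z := by
  simpa only [natCast_zsmul] using der_zsmul ρ b (c : ℤ) F z

lemma der_finsetSum {α : Type*} (s : Finset α) (b : Y) (F : α → (ι → X) → V) (z : ι → X) :
    der ρ b (fun y => ∑ a ∈ s, F a y) z = ∑ a ∈ s, der ρ b (F a) z := by
  simp only [der, Finset.sum_neg_distrib]
  rw [Finset.sum_comm]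

lemma der_comp_equiv (b : Y) (e : ι ≃ κ) (F : (ι → X) → V) (z : κ → X) :
    der ρ b (fun y => F (fun i => y (e i))) z = der ρ b F (fun i => z (e i)) := by
  unfold der
  congr 1
  refine (Fintype.sum_equiv e _ _ fun i => ?_).symm
  congr 1
  funext j
  by_cases h : j = i
  · subst h
    simp
  · rw [Function.update_of_ne h, Function.update_of_ne (e.injective.ne h)]

lemma IsSkew.der {F : (ι → X) → V} (hF : IsSkew F) (b : Y) : IsSkew (der ρ b F) := by
  intro σ x
  rw [← der_comp_equiv ρ b σ F x, ← der_zsmul]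
  congr 1
  funext y
  exact hF σ y

lemma der_sum_index (b : Y) (k : (ι ⊕ κ → X) → V) (z : ι ⊕ κ → X) :
    der ρ b k z =
      der ρ b (fun u => k (Sum.elim u fun i => z (Sum.inr i))) (fun i => z (Sum.inl i)) +
        der ρ b (fun v => k (Sum.elim (fun i => z (Sum.inl i)) v)) (fun i => z (Sum.inr i)) := by
  unfold der
  rw [Fintype.sum_sum_type, neg_add]
  congr 2
  · refine Finset.sum_congr rfl fun i _ => congrArg k ?_
    funext j
    rcases j with j | j <;> simp [Function.update_apply]
  · refine Finset.sum_congr rfl fun i _ => congrArg k ?_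
    funext j
    rcases j with j | j <;> simp [Function.update_apply]

lemma MultilinearMap.derAdditive [Module R V] (F : MultilinearMap R (fun _ : ι => X) V) :
    DerAdditive ρ ⇑F := by
  intro b b' z
  simp only [der, map_add, LinearMap.add_apply, MultilinearMap.map_update_add,
    Finset.sum_add_distrib, neg_add]

lemma AlternatingMap.derAdditive [Module R V] (F : AlternatingMap R X V ι) :
    DerAdditive ρ ⇑F :=
  MultilinearMap.derAdditive ρ F.toMultilinearMap

lemma AlternatingMap.der_smul_left [Module R V] (F : AlternatingMap R X V ι) (c : R) (b : Y)
    (z : ι → X) : der ρ (c • b) ⇑F z = c • der ρ b ⇑F z := by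
  simp only [der, map_smul, LinearMap.smul_apply, AlternatingMap.map_update_smul,
    ← Finset.smul_sum, smul_neg]

lemma MultilinearMap.der_der_sub [Module R V] (F : MultilinearMap R (fun _ : ι => X) V)
    (a b c : Y) (hc : ∀ x, ρ c x = ρ a (ρ b x) - ρ b (ρ a x)) (z : ι → X) :
    der ρ a (der ρ b ⇑F) z - der ρ b (der ρ a ⇑F) z = der ρ c ⇑F z := by
  set T : Y → Y → ι → ι → V := fun a b j i =>
    if i = j then F (Function.update z j (ρ b (ρ a (z j))))
      else F (Function.update (Function.update z j (ρ a (z j))) i (ρ b (z i))) with hT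
  have h1 : ∀ a b, der ρ a (der ρ b ⇑F) z = ∑ j, ∑ i, T a b j i := by
    intro a b
    simp only [der, Finset.sum_neg_distrib, neg_neg]
    refine Finset.sum_congr rfl fun j _ => Finset.sum_congr rfl fun i _ => ?_
    by_cases h : i = j
    · subst h
      simp [hT]
    · simp [hT, h]
  rw [h1, h1, Finset.sum_comm (f := T b a), ← Finset.sum_sub_distrib]
  unfold der
  rw [← Finset.sum_neg_distrib]
  refine Finset.sum_congr rfl fun j _ => ?_
  rw [← Finset.sum_sub_distrib, Finset.sum_eq_single j]
  · simp [hT, hc, MultilinearMap.map_update_sub]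
  · intro i _ hij
    simp only [hT, if_neg hij, if_neg hij.symm]
    rw [Function.update_comm hij, sub_self]
  · simp

lemma AlternatingMap.der_der_sub [Module R V] (F : AlternatingMap R X V ι)
    (a b c : Y) (hc : ∀ x, ρ c x = ρ a (ρ b x) - ρ b (ρ a x)) (z : ι → X) :
    der ρ a (der ρ b ⇑F) z - der ρ b (der ρ a ⇑F) z = der ρ c ⇑F z :=
  MultilinearMap.der_der_sub ρ F.toMultilinearMap a b c hc z

variable {ρ} in
lemma DerAdditive.of_nsmul [IsAddTorsionFree V] {F : (ι → X) → V} {f : (κ → X) → V}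
    (e : κ ≃ ι) {c : ℕ} (hc : c ≠ 0) (h : ∀ y, c • F y = altSum f (fun i => y (e i)))
    (hf : DerAdditive ρ f) : DerAdditive ρ F := by
  have h1 : ∀ b z, c • der ρ b F z = ∑ σ : Equiv.Perm κ,
      (Equiv.Perm.sign σ : ℤ) • der ρ b f (fun i => z (e (σ i))) := by
    intro b z
    rw [← der_nsmul]
    simp_rw [h]
    unfold altSum
    rw [der_finsetSum]
    refine Finset.sum_congr rfl fun σ _ => ?_
    rw [der_zsmul]
    congr 1
    exact der_comp_equiv ρ b (σ.trans e) f z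
  intro b b' z
  refine nsmul_right_injective hc ?_
  simp only [h1, hf b b', smul_add, Finset.sum_add_distrib]

/-- The product of a scalar-valued function and a module-valued function in separate blocks of
arguments. -/
def blockMul [Module R V] (g : (ι → X) → R) (F : (κ → X) → V) (z : ι ⊕ κ → X) : V :=
  g (fun i => z (Sum.inl i)) • F (fun i => z (Sum.inr i))

/-- The derivation action of the values of `F` on `G`, in separate blocks of arguments. -/
def blockAct (F : (ι → X) → Y) (G : (κ → X) → V) (z : ι ⊕ κ → X) : V :=
  der ρ (F fun i => z (Sum.inl i)) G (fun i => z (Sum.inr i))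

/-- The bracket of `Y`-valued functions in separate blocks of arguments, before
antisymmetrization. -/
def blockBracket (β : Y →ₗ[R] Y →ₗ[R] Y) (F : (ι → X) → Y) (G : (κ → X) → Y)
    (z : ι ⊕ κ → X) : Y :=
  β (F fun i => z (Sum.inl i)) (G fun i => z (Sum.inr i)) +
    der ρ (F fun i => z (Sum.inl i)) G (fun i => z (Sum.inr i)) -
    der ρ (G fun i => z (Sum.inr i)) F (fun i => z (Sum.inl i))

variable (β : Y →ₗ[R] Y →ₗ[R] Y)

variable {ρ} in
lemma blockAct_isBlockSkew {F : (ι → X) → Y} {G : (κ → X) → V} (hF : IsSkew F) (hG : IsSkew G)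
    (hG' : DerAdditive ρ G) : IsBlockSkew (blockAct ρ F G) := by
  intro σ τ z
  have h1 := hF σ (fun i => z (Sum.inl i))
  have h2 := fun b => hG.der ρ b τ (fun i => z (Sum.inr i))
  simp only [blockAct, Equiv.Perm.sumCongr_apply, Sum.map_inl, Sum.map_inr, h1, h2, hG'.map_zsmul,
    smul_smul, mul_comm]

lemma blockMul_isBlockSkew {Z : Type*} [Module R V] {g : (ι → Z) → R} {F : (κ → Z) → V} (hg : IsSkew g)
    (hF : IsSkew F) : IsBlockSkew (blockMul g F) := by
  intro σ τ z
  have h1 := hg σ (fun i => z (Sum.inl i))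
  have h2 := hF τ (fun i => z (Sum.inr i))
  simp only [blockMul, Equiv.Perm.sumCongr_apply, Sum.map_inl, Sum.map_inr, h1, h2, smul_assoc,
    mul_smul]
  congr 1
  exact smul_comm _ _ _

lemma blockBracket_comp_equiv (e : ι ≃ ι') (e' : κ ≃ κ') (F : (ι → X) → Y) (G : (κ → X) → Y)
    (z : ι' ⊕ κ' → X) :
    blockBracket ρ β (fun y => F fun i => y (e i)) (fun y => G fun i => y (e' i)) z =
      blockBracket ρ β F G (fun i => z (Equiv.sumCongr e e' i)) := by
  simp only [blockBracket, der_comp_equiv, Equiv.sumCongr_apply, Sum.map_inl, Sum.map_inr]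

/-- `blockBracket` with a fixed right argument as an additive map. -/
def blockBracketRight {ρ : Y →ₗ[R] X →ₗ[R] X} {G : (κ → X) → Y} (hG : DerAdditive ρ G) :
    ((ι → X) → Y) →+ ((ι ⊕ κ → X) → Y) :=
  AddMonoidHom.mk' (fun F => blockBracket ρ β F G) fun F F' => by
    funext z
    have h := der_add ρ (G fun i => z (Sum.inr i)) F F' (fun i => z (Sum.inl i))
    simp only [blockBracket, Pi.add_apply, map_add, LinearMap.add_apply, hG _ _ _,
      show F + F' = fun y => F y + F' y from rfl, h]
    abel

/-- `blockBracket` with a fixed left argument as an additive map. -/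
def blockBracketLeft {ρ : Y →ₗ[R] X →ₗ[R] X} {F : (ι → X) → Y} (hF : DerAdditive ρ F) :
    ((κ → X) → Y) →+ ((ι ⊕ κ → X) → Y) :=
  AddMonoidHom.mk' (fun G => blockBracket ρ β F G) fun G G' => by
    funext z
    have h := der_add ρ (F fun i => z (Sum.inl i)) G G' (fun i => z (Sum.inr i))
    simp only [blockBracket, Pi.add_apply, map_add, hF _ _ _,
      show G + G' = fun y => G y + G' y from rfl, h]
    abel

/-- `blockMul` with a fixed right argument as an additive map. -/
def blockMulRight [Module R V] (F : (κ → X) → V) :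
    ((ι → X) → R) →+ ((ι ⊕ κ → X) → V) :=
  AddMonoidHom.mk' (fun g => blockMul g F) fun g g' => by
    funext z
    simp only [blockMul, Pi.add_apply, add_smul]

/-- `blockMul` with a fixed left argument as an additive map. -/
def blockMulLeft [Module R V] (g : (ι → X) → R) :
    ((κ → X) → V) →+ ((ι ⊕ κ → X) → V) :=
  AddMonoidHom.mk' (fun F => blockMul g F) fun F F' => by
    funext z
    simp only [blockMul, Pi.add_apply, smul_add]

lemma blockBracket_swap (hβ : ∀ a b, β a b = -β b a) (F : (ι → X) → Y) (G : (κ → X) → Y)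
    (z : ι ⊕ κ → X) :
    blockBracket ρ β G F (fun i => z (Equiv.sumComm κ ι i)) = -blockBracket ρ β F G z := by
  simp only [blockBracket, Equiv.sumComm_apply, Sum.swap_inl, Sum.swap_inr]
  rw [hβ]
  abel

lemma der_blockMul [Module R V] (b : Y) (g : (ι → X) → R) (F : (κ → X) → V) (z : ι ⊕ κ → X) :
    der ρ b (blockMul g F) z =
      blockMul (der ρ b g) F z + blockMul g (der ρ b F) z := by
  rw [der_sum_index]
  simp only [blockMul, Sum.elim_inl, Sum.elim_inr]
  congr 1
  · exact der_map ρ b ((LinearMap.id (R := R) (M := R)).smulRight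
      (F fun i => z (Sum.inr i))).toAddMonoidHom g _
  · exact der_map ρ b (DistribSMul.toAddMonoidHom V (g fun i => z (Sum.inl i))) F _

variable {ρ} in
lemma DerAdditive.blockMul [Module R V] {g : (ι → X) → R} {F : (κ → X) → V}
    (hg : DerAdditive ρ g) (hF : DerAdditive ρ F) : DerAdditive ρ (blockMul g F) := by
  intro b b' z
  rw [der_blockMul, der_blockMul, der_blockMul]
  simp only [_root_.blockMul, hg _ _ _, hF _ _ _, add_smul, smul_add]
  abel

variable {ρ} in
lemma der_blockBracket {F : (ι → X) → Y} {G : (κ → X) → Y} (hF : DerAdditive ρ F)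
    (hG : DerAdditive ρ G) (b : Y) (z : ι ⊕ κ → X) :
    der ρ b (blockBracket ρ β F G) z =
      β (der ρ b F fun i => z (Sum.inl i)) (G fun i => z (Sum.inr i)) +
      β (F fun i => z (Sum.inl i)) (der ρ b G fun i => z (Sum.inr i)) +
      der ρ (der ρ b F fun i => z (Sum.inl i)) G (fun i => z (Sum.inr i)) +
      der ρ b (der ρ (F fun i => z (Sum.inl i)) G) (fun i => z (Sum.inr i)) -
      der ρ (der ρ b G fun i => z (Sum.inr i)) F (fun i => z (Sum.inl i)) -
      der ρ b (der ρ (G fun i => z (Sum.inr i)) F) (fun i => z (Sum.inl i)) := by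
  rw [der_sum_index]
  simp only [blockBracket, Sum.elim_inl, Sum.elim_inr]
  rw [der_sub, der_add, der_sub, der_add]
  have h1 := der_map ρ b (β.flip (G fun i => z (Sum.inr i))).toAddMonoidHom F
    (fun i => z (Sum.inl i))
  have h2 := der_map ρ b (β (F fun i => z (Sum.inl i))).toAddMonoidHom G
    (fun i => z (Sum.inr i))
  have h3 := der_map ρ b (hG.hom fun i => z (Sum.inr i)) F (fun i => z (Sum.inl i))
  have h4 := der_map ρ b (hF.hom fun i => z (Sum.inl i)) G (fun i => z (Sum.inr i))
  simp only [LinearMap.toAddMonoidHom_coe, LinearMap.flip_apply, DerAdditive.hom,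
    AddMonoidHom.mk'_apply] at h1 h2 h3 h4
  rw [h1, h2, h3, h4]
  change _ + _ - der ρ b (der ρ (G fun i => z (Sum.inr i)) F) _ +
    (_ + der ρ b (der ρ (F fun i => z (Sum.inl i)) G) _ - _) = _
  abel

variable {ρ β}

lemma blockBracket_derAdditive (hρ : ∀ a b x, ρ (β a b) x = ρ a (ρ b x) - ρ b (ρ a x))
    (F : AlternatingMap R X Y ι) (G : AlternatingMap R X Y κ) :
    DerAdditive ρ (blockBracket ρ β ⇑F ⇑G) := by
  have hF := F.derAdditive ρ
  have hG := G.derAdditive ρ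
  have h1 : ∀ a b z, der ρ a (der ρ b ⇑F) z = der ρ b (der ρ a ⇑F) z + der ρ (β a b) ⇑F z :=
    fun a b z => by rw [← F.der_der_sub ρ a b _ (hρ a b) z]; abel
  have h2 : ∀ a b z, der ρ a (der ρ b ⇑G) z = der ρ b (der ρ a ⇑G) z + der ρ (β a b) ⇑G z :=
    fun a b z => by rw [← G.der_der_sub ρ a b _ (hρ a b) z]; abel
  have h3 : ∀ b b', der ρ (b + b') ⇑F = fun z => der ρ b ⇑F z + der ρ b' ⇑F z :=
    fun b b' => funext fun z => hF b b' z
  have h4 : ∀ b b', der ρ (b + b') ⇑G = fun z => der ρ b ⇑G z + der ρ b' ⇑G z :=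
    fun b b' => funext fun z => hG b b' z
  intro b b' z
  rw [der_blockBracket β hF hG, der_blockBracket β hF hG, der_blockBracket β hF hG]
  rw [h1 (b + b'), h1 b, h1 b', h2 (b + b'), h2 b, h2 b']
  simp only [h3, h4, der_add, map_add, LinearMap.add_apply]
  abel

lemma blockBracket_blockBracket (F : AlternatingMap R X Y ι) (G : AlternatingMap R X Y κ)
    (H : AlternatingMap R X Y ι') (z : (ι ⊕ κ) ⊕ ι' → X) (u : ι → X) (v : κ → X) (w : ι' → X)
    (hu : ∀ i, z (Sum.inl (Sum.inl i)) = u i) (hv : ∀ i, z (Sum.inl (Sum.inr i)) = v i)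
    (hw : ∀ i, z (Sum.inr i) = w i) :
    blockBracket ρ β (blockBracket ρ β ⇑F ⇑G) ⇑H z =
      β (β (F u) (G v)) (H w) + β (der ρ (F u) ⇑G v) (H w) - β (der ρ (G v) ⇑F u) (H w) +
      (der ρ (β (F u) (G v)) ⇑H w + der ρ (der ρ (F u) ⇑G v) ⇑H w -
        der ρ (der ρ (G v) ⇑F u) ⇑H w) -
      (β (der ρ (H w) ⇑F u) (G v) + β (F u) (der ρ (H w) ⇑G v) +
        der ρ (der ρ (H w) ⇑F u) ⇑G v + der ρ (H w) (der ρ (F u) ⇑G) v -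
        der ρ (der ρ (H w) ⇑G v) ⇑F u - der ρ (H w) (der ρ (G v) ⇑F) u) := by
  obtain rfl : (fun i => z (Sum.inl (Sum.inl i))) = u := funext hu
  obtain rfl : (fun i => z (Sum.inl (Sum.inr i))) = v := funext hv
  obtain rfl : (fun i => z (Sum.inr i)) = w := funext hw
  have hH := H.derAdditive ρ
  have aH : ∀ a b z, der ρ (a + b) ⇑H z = der ρ a ⇑H z + der ρ b ⇑H z := hH
  have sH : ∀ a b z, der ρ (a - b) ⇑H z = der ρ a ⇑H z - der ρ b ⇑H z :=
    fun a b z => map_sub (hH.hom z) a b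
  rw [blockBracket, der_blockBracket β (F.derAdditive ρ) (G.derAdditive ρ)]
  congr 1
  simp only [blockBracket, map_add, map_sub, LinearMap.add_apply, LinearMap.sub_apply, aH, sH]

/-- The Jacobi identity for the bracket before antisymmetrization. -/
lemma blockBracket_jacobi (hβ : ∀ a b, β a b = -β b a)
    (hJ : ∀ a b c, β (β a b) c + β (β b c) a + β (β c a) b = 0)
    (hρ : ∀ a b x, ρ (β a b) x = ρ a (ρ b x) - ρ b (ρ a x))
    (F : AlternatingMap R X Y ι) (G : AlternatingMap R X Y κ) (H : AlternatingMap R X Y ι')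
    (z : (ι ⊕ κ) ⊕ ι' → X) :
    blockBracket ρ β (blockBracket ρ β ⇑F ⇑G) ⇑H z +
      blockBracket ρ β (blockBracket ρ β ⇑G ⇑H) ⇑F
        (fun i => z (((Equiv.sumComm (κ ⊕ ι') ι).trans (Equiv.sumAssoc ι κ ι').symm) i)) +
      blockBracket ρ β (blockBracket ρ β ⇑H ⇑F) ⇑G
        (fun i => z (((Equiv.sumAssoc ι' ι κ).trans (Equiv.sumComm ι' (ι ⊕ κ))) i)) = 0 := by
  set u : ι → X := fun i => z (Sum.inl (Sum.inl i)) with hu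
  set v : κ → X := fun i => z (Sum.inl (Sum.inr i)) with hv
  set w : ι' → X := fun i => z (Sum.inr i) with hw
  have cF := F.der_der_sub ρ (G v) (H w) _ (hρ _ _) u
  have cG := G.der_der_sub ρ (H w) (F u) _ (hρ _ _) v
  have cH := H.der_der_sub ρ (F u) (G v) _ (hρ _ _) w
  rw [blockBracket_blockBracket F G H z u v w (fun _ => rfl) (fun _ => rfl) (fun _ => rfl),
    blockBracket_blockBracket G H F _ v w u (fun _ => rfl) (fun _ => rfl) (fun _ => rfl),
    blockBracket_blockBracket H F G _ w u v (fun _ => rfl) (fun _ => rfl) (fun _ => rfl)]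
  rw [hβ (F u) (der ρ (H w) ⇑G v), hβ (G v) (der ρ (F u) ⇑H w), hβ (H w) (der ρ (G v) ⇑F u),
    ← cF, ← cG, ← cH, ← sub_eq_zero.2 (hJ (F u) (G v) (H w))]
  abel

/-- The Leibniz rule for the bracket before antisymmetrization. -/
lemma blockBracket_blockMul (F : AlternatingMap R X Y ι) (g : (κ → X) → R) (G : (ι' → X) → Y)
    (z : ι ⊕ (κ ⊕ ι') → X) :
    blockBracket ρ β ⇑F (blockMul g G) z =
      blockMul (blockAct ρ ⇑F g) G (fun i => z (Equiv.sumAssoc ι κ ι' i)) +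
        blockMul g (blockBracket ρ β ⇑F G) (fun i => z (sumLeftComm ι κ ι' i)) := by
  rw [blockBracket, der_blockMul]
  simp only [blockMul, blockAct, blockBracket, map_smul, F.der_smul_left, smul_add, smul_sub]
  have h : ∀ a b c d : Y, a + (b + c) - d = b + (a + c - d) := fun a b c d => by abel
  exact h _ _ _ _

end Derivations
section BlockSigns

open Equiv Equiv.Perm

/-- The enumeration of three blocks of indices, associated to the left. -/
def finSumFinSumFinEquiv (p q t : ℕ) : (Fin p ⊕ Fin q) ⊕ Fin t ≃ Fin (p + q + t) :=
  (Equiv.sumCongr finSumFinEquiv (Equiv.refl _)).trans finSumFinEquiv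

/-- The enumeration of three blocks of indices, associated to the right. -/
def finSumFinSumFinEquiv' (p q t : ℕ) : Fin p ⊕ (Fin q ⊕ Fin t) ≃ Fin (p + (q + t)) :=
  (Equiv.sumCongr (Equiv.refl _) finSumFinEquiv).trans finSumFinEquiv

lemma transition_apply {ι ι' κ : Type*} (e : ι ≃ κ) (e' : ι' ≃ κ) (r : ι' ≃ ι) (i : ι) :
    (e.symm.trans (r.symm.trans e')) (e i) = e' (r.symm i) := by
  simp

lemma sign_sumComm_transition (p q : ℕ) (h : q + p = p + q) :
    (sign ((finSumFinEquiv : Fin p ⊕ Fin q ≃ _).symm.trans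
      ((Equiv.sumComm (Fin q) (Fin p)).symm.trans (finSumFinEquiv.trans (finCongr h)))) : ℤ) =
      (-1) ^ (p * q) := by
  refine sign_eq_of_rotate rfl _ fun i => ?_
  obtain ⟨i, rfl⟩ := (finSumFinEquiv : Fin p ⊕ Fin q ≃ _).surjective i
  rw [transition_apply]
  rcases i with i | i
  · have := i.2
    simp [Nat.add_comm]
  · simp

/-- The sign of a permutation exchanging the first two blocks, of lengths `p` and `m`, and fixing
the remaining indices. -/
lemma sign_eq_of_rotate_left {N p m k : ℕ} (hN : p + m + k = N) (π : Perm (Fin N))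
    (hπ : ∀ i : Fin N, (π i : ℕ) =
      if (i : ℕ) < p then i + m else if (i : ℕ) < p + m then i - p else i) :
    (sign π : ℤ) = (-1) ^ (p * m) := by
  subst hN
  have h : π = finSumFinEquiv.permCongr (Perm.sumCongr
      (finSumFinEquiv.symm.trans ((Equiv.sumComm (Fin m) (Fin p)).symm.trans
        (finSumFinEquiv.trans (finCongr (Nat.add_comm m p))))) (1 : Perm (Fin k))) := by
    ext i
    rw [hπ]
    obtain ⟨i, rfl⟩ := (finSumFinEquiv : Fin (p + m) ⊕ Fin k ≃ _).surjective i
    rw [Equiv.permCongr_apply, Equiv.symm_apply_apply]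
    rcases i with i | i
    · obtain ⟨i, rfl⟩ := (finSumFinEquiv : Fin p ⊕ Fin m ≃ _).surjective i
      rw [Perm.sumCongr_apply, Sum.map_inl, transition_apply]
      rcases i with i | i
      · have := i.2
        simp [Nat.add_comm]
      · simp
    · simp
      omega
  rw [h, sign_permCongr, sign_sumCongr, Perm.sign_one, mul_one, sign_sumComm_transition]

lemma sign_rotate_transition (p q t : ℕ) (h : q + t + p = p + q + t) :
    (sign ((finSumFinSumFinEquiv p q t).symm.trans
      (((Equiv.sumComm (Fin q ⊕ Fin t) (Fin p)).trans
        (Equiv.sumAssoc (Fin p) (Fin q) (Fin t)).symm).symm.trans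
        ((finSumFinSumFinEquiv q t p).trans (finCongr h)))) : ℤ) = (-1) ^ (p * (q + t)) := by
  refine sign_eq_of_rotate (by omega) _ fun i => ?_
  obtain ⟨i, rfl⟩ := (finSumFinSumFinEquiv p q t).surjective i
  rw [transition_apply]
  rcases i with (i | i) | i
  · have := i.2
    simp [finSumFinSumFinEquiv]
    omega
  · simp [finSumFinSumFinEquiv]
  · simp [finSumFinSumFinEquiv]
    split_ifs <;> omega

lemma sign_rotate_symm_transition (p q t : ℕ) (h : t + p + q = p + q + t) :
    (sign ((finSumFinSumFinEquiv p q t).symm.trans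
      (((Equiv.sumAssoc (Fin t) (Fin p) (Fin q)).trans
        (Equiv.sumComm (Fin t) (Fin p ⊕ Fin q))).symm.trans
        ((finSumFinSumFinEquiv t p q).trans (finCongr h)))) : ℤ) = (-1) ^ ((p + q) * t) := by
  refine sign_eq_of_rotate rfl _ fun i => ?_
  obtain ⟨i, rfl⟩ := (finSumFinSumFinEquiv p q t).surjective i
  rw [transition_apply]
  rcases i with (i | i) | i
  · have := i.2
    simp [finSumFinSumFinEquiv]
    split_ifs <;> omega
  · have := i.2
    simp [finSumFinSumFinEquiv]
    omega
  · simp [finSumFinSumFinEquiv]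

lemma sign_assoc_transition (p t q : ℕ) (h : p + t + q = p + (t + q)) :
    (sign ((finSumFinSumFinEquiv' p t q).symm.trans
      ((Equiv.sumAssoc (Fin p) (Fin t) (Fin q)).symm.trans
        ((finSumFinSumFinEquiv p t q).trans (finCongr h)))) : ℤ) = 1 := by
  rw [show (finSumFinSumFinEquiv' p t q).symm.trans
      ((Equiv.sumAssoc (Fin p) (Fin t) (Fin q)).symm.trans
        ((finSumFinSumFinEquiv p t q).trans (finCongr h))) = Equiv.refl _ from ?_, sign_refl,
    Units.val_one]
  ext i
  obtain ⟨i, rfl⟩ := (finSumFinSumFinEquiv' p t q).surjective i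
  rw [transition_apply]
  rcases i with i | i | i <;>
    simp [finSumFinSumFinEquiv, finSumFinSumFinEquiv', Nat.add_assoc]

lemma sign_leftComm_transition (p t q : ℕ) (h : t + (p + q) = p + (t + q)) :
    (sign ((finSumFinSumFinEquiv' p t q).symm.trans
      ((sumLeftComm (Fin p) (Fin t) (Fin q)).symm.trans
        ((finSumFinSumFinEquiv' t p q).trans (finCongr h)))) : ℤ) = (-1) ^ (p * t) := by
  refine sign_eq_of_rotate_left (k := q) (by omega) _ fun i => ?_
  obtain ⟨i, rfl⟩ := (finSumFinSumFinEquiv' p t q).surjective i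
  rw [transition_apply]
  rcases i with i | i | i
  · have := i.2
    simp [finSumFinSumFinEquiv', sumLeftComm]
    omega
  · simp [finSumFinSumFinEquiv', sumLeftComm]
  · simp [finSumFinSumFinEquiv', sumLeftComm]
    omega

end BlockSigns

section MatchedPair

open Equiv Equiv.Perm

variable {F M : Type*} [Field F] [LieRing M] [LieAlgebra F M]

lemma bott_eq_projectionOnto (A B : Submodule F M) (hc : IsCompl A B) (b : ↥B) (a : ↥A) :
    bott A B hc b a = A.projectionOnto B hc ⁅(b : M), (a : M)⁆ :=
  rfl

/-- The Bott action of `B` on `A` as a bilinear map. -/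
def bottMap (A B : Submodule F M) (hc : IsCompl A B) : ↥B →ₗ[F] ↥A →ₗ[F] ↥A :=
  LinearMap.mk₂ F (bott A B hc)
    (fun b b' a => by
      simp only [bott_eq_projectionOnto, Submodule.coe_add, add_lie, map_add])
    (fun c b a => by
      simp only [bott_eq_projectionOnto, Submodule.coe_smul, smul_lie, map_smul])
    (fun b a a' => by
      simp only [bott_eq_projectionOnto, Submodule.coe_add, lie_add, map_add])
    (fun c b a => by
      simp only [bott_eq_projectionOnto, Submodule.coe_smul, lie_smul, map_smul])

lemma bottMap_apply (A B : Submodule F M) (hc : IsCompl A B) (b : ↥B) (a : ↥A) :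
    bottMap A B hc b a = bott A B hc b a :=
  rfl

/-- The Lie bracket of the subalgebra `B` as a bilinear map. -/
def lieMap (B : Submodule F M) (hB : ∀ x y : M, x ∈ B → y ∈ B → ⁅x, y⁆ ∈ B) :
    ↥B →ₗ[F] ↥B →ₗ[F] ↥B :=
  LinearMap.mk₂ F (fun u v => ⟨⁅(u : M), (v : M)⁆, hB _ _ u.2 v.2⟩)
    (fun _ _ _ => Subtype.ext (by simp))
    (fun _ _ _ => Subtype.ext (by simp))
    (fun _ _ _ => Subtype.ext (by simp))
    (fun _ _ _ => Subtype.ext (by simp))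

lemma coe_lieMap (B : Submodule F M) (hB : ∀ x y : M, x ∈ B → y ∈ B → ⁅x, y⁆ ∈ B) (u v : ↥B) :
    (lieMap B hB u v : M) = ⁅(u : M), (v : M)⁆ :=
  rfl

variable {A B : Submodule F M} (hc : IsCompl A B)
  (hB : ∀ x y : M, x ∈ B → y ∈ B → ⁅x, y⁆ ∈ B)

lemma lieMap_skew (u v : ↥B) : lieMap B hB u v = -lieMap B hB v u :=
  Subtype.ext (by simp [coe_lieMap])

lemma lieMap_jacobi (u v w : ↥B) :
    lieMap B hB (lieMap B hB u v) w + lieMap B hB (lieMap B hB v w) u +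
      lieMap B hB (lieMap B hB w u) v = 0 := by
  refine Subtype.ext ?_
  have h := lie_jacobi (u : M) (v : M) (w : M)
  rw [← lie_skew, ← lie_skew _ ⁅(w : M), _⁆, ← lie_skew _ ⁅(u : M), _⁆] at h
  simp only [Submodule.coe_add, coe_lieMap, Submodule.coe_zero]
  rw [← neg_eq_zero, ← h]
  abel

lemma bottMap_lieMap (b b' : ↥B) (a : ↥A) :
    bottMap A B hc (lieMap B hB b b') a =
      bottMap A B hc b (bottMap A B hc b' a) - bottMap A B hc b' (bottMap A B hc b a) := by
  have h : ∀ (c : ↥B) (x : M), A.projectionOnto B hc ⁅(c : M), (A.projectionOnto B hc x : M)⁆ =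
      A.projectionOnto B hc ⁅(c : M), x⁆ := by
    intro c x
    rw [eq_comm, ← sub_eq_zero, ← map_sub, ← lie_sub, Submodule.projectionOnto_apply_eq_zero_iff]
    refine hB _ _ c.2 ?_
    rw [← Submodule.projectionOnto_apply_eq_zero_iff hc, map_sub,
      Submodule.projectionOnto_apply_left, sub_self]
  simp only [bottMap_apply, bott_eq_projectionOnto, coe_lieMap, h]
  rw [lie_lie, map_sub]

lemma brC_eq_sum_unshuffles (p q : ℕ) (Φ : (Fin p → ↥A) → ↥B) (Ψ : (Fin q → ↥A) → ↥B)
    (x : Fin (p + q) → ↥A) :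
    brC A B hc hB p q Φ Ψ x =
      (∑ σ ∈ unshuffles p q, (sign σ : ℤ) • (fun z : Fin p ⊕ Fin q → ↥A =>
        lieMap B hB (Φ fun i => z (Sum.inl i)) (Ψ fun i => z (Sum.inr i)))
          (fun i => x (σ (finSumFinEquiv i)))) +
      (∑ σ ∈ unshuffles p q, (sign σ : ℤ) • blockAct (bottMap A B hc) Φ Ψ
        (fun i => x (σ (finSumFinEquiv i)))) -
      (-1 : ℤ) ^ (p * q) • ∑ σ ∈ unshuffles q p, (sign σ : ℤ) • blockAct (bottMap A B hc) Ψ Φ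
        (fun i => x (Fin.cast (Nat.add_comm q p) (σ (finSumFinEquiv i)))) := by
  simp only [blockAct, der, smul_neg, Finset.sum_neg_distrib, sub_neg_eq_add, ← sub_eq_add_neg]
  rfl

lemma factorial_smul_brC {p q : ℕ} {Φ : (Fin p → ↥A) → ↥B} {Ψ : (Fin q → ↥A) → ↥B}
    (hΦ : IsSkew Φ) (hΦ' : DerAdditive (bottMap A B hc) Φ) (hΨ : IsSkew Ψ)
    (hΨ' : DerAdditive (bottMap A B hc) Ψ) (x : Fin (p + q) → ↥A) :
    (p.factorial * q.factorial) • brC A B hc hB p q Φ Ψ x =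
      altSum (blockBracket (bottMap A B hc) (lieMap B hB) Φ Ψ)
        (fun i => x (finSumFinEquiv i)) := by
  have hk : IsBlockSkew (fun z : Fin p ⊕ Fin q → ↥A =>
      lieMap B hB (Φ fun i => z (Sum.inl i)) (Ψ fun i => z (Sum.inr i))) := by
    intro σ τ z
    have h1 := hΦ σ (fun i => z (Sum.inl i))
    have h2 := hΨ τ (fun i => z (Sum.inr i))
    simp only [Perm.sumCongr_apply, Sum.map_inl, Sum.map_inr, h1, h2, map_zsmul,
      LinearMap.smul_apply, smul_smul, mul_comm]
  rw [brC_eq_sum_unshuffles, nsmul_sub, nsmul_add, factorial_smul_sum_unshuffles p q _ hk,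
    factorial_smul_sum_unshuffles p q _ (blockAct_isBlockSkew hΦ hΨ hΨ'), smul_comm,
    mul_comm p.factorial,
    factorial_smul_sum_unshuffles q p _ (blockAct_isBlockSkew hΨ hΦ hΦ')
      (fun i => x (Fin.cast (Nat.add_comm q p) i))]
  have h := altSum_reindex finSumFinEquiv (finSumFinEquiv.trans (finCongr (Nat.add_comm q p)))
    (Equiv.sumComm (Fin q) (Fin p)) (blockAct (bottMap A B hc) Ψ Φ) x
  rw [sign_sumComm_transition] at h
  change _ - _ • altSum _ (fun i => x ((finSumFinEquiv.trans
    (finCongr (Nat.add_comm q p))) i)) = _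
  rw [h, smul_smul, ← mul_pow, neg_one_mul, neg_neg, one_pow, one_smul, ← altSum_add, ← altSum_sub]
  rfl

lemma factorial_smul_wmul {t q : ℕ} {g : (Fin t → ↥A) → F} {Ψ : (Fin q → ↥A) → ↥B}
    (hg : IsSkew g) (hΨ : IsSkew Ψ) (x : Fin (t + q) → ↥A) :
    (t.factorial * q.factorial) • wmul t q g Ψ x =
      altSum (blockMul g Ψ) (fun i => x (finSumFinEquiv i)) :=
  factorial_smul_sum_unshuffles t q _ (blockMul_isBlockSkew hg hΨ) x

lemma factorial_smul_wK {t q : ℕ} {g : (Fin t → ↥A) → F} {h : (Fin q → ↥A) → F}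
    (hg : IsSkew g) (hh : IsSkew h) (x : Fin (t + q) → ↥A) :
    (t.factorial * q.factorial) • wK t q g h x =
      altSum (blockMul g h) (fun i => x (finSumFinEquiv i)) :=
  factorial_smul_sum_unshuffles t q _ (blockMul_isBlockSkew hg hh) x

lemma factorial_smul_anchorAct {p t : ℕ} {Φ : (Fin p → ↥A) → ↥B} {g : (Fin t → ↥A) → F}
    (hΦ : IsSkew Φ) (hg : IsSkew g) (hg' : DerAdditive (bottMap A B hc) g)
    (x : Fin (p + t) → ↥A) :
    (p.factorial * t.factorial) • anchorAct A B hc p t Φ g x =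
      altSum (blockAct (bottMap A B hc) Φ g) (fun i => x (finSumFinEquiv i)) := by
  rw [← factorial_smul_sum_unshuffles p t _ (blockAct_isBlockSkew hΦ hg hg') x]
  congr 1
  simp only [blockAct, der, smul_neg, Finset.sum_neg_distrib]
  rfl

lemma bottForm_eq_der (q : ℕ) (b : ↥B) (η : (Fin q → ↥A) → F) :
    bottForm A B hc q b η = der (bottMap A B hc) b η :=
  rfl

lemma factorial_mul_factorial_ne_zero (p q : ℕ) : p.factorial * q.factorial ≠ 0 :=
  mul_ne_zero p.factorial_ne_zero q.factorial_ne_zero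

/-- On decomposable cochains the bracket is given by the three-term formula. -/
lemma brC_smul_smul [IsAddTorsionFree ↥B] {p q : ℕ} (ξ : AlternatingMap F ↥A F (Fin p))
    (η : AlternatingMap F ↥A F (Fin q)) (b₁ b₂ : ↥B) (x : Fin (p + q) → ↥A) :
    brC A B hc hB p q (fun y => ξ y • b₁) (fun y => η y • b₂) x =
      wK p q ⇑ξ ⇑η x • lieMap B hB b₁ b₂ + wK p q ⇑ξ (bottForm A B hc q b₁ ⇑η) x • b₂ -
        wK p q (bottForm A B hc p b₂ ⇑ξ) ⇑η x • b₁ := by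
  refine nsmul_right_injective (factorial_mul_factorial_ne_zero p q) ?_
  set φ := (LinearMap.toSpanSingleton F ↥B b₁).compAlternatingMap ξ
  set ψ := (LinearMap.toSpanSingleton F ↥B b₂).compAlternatingMap η
  have h1 := factorial_smul_brC hc hB φ.isSkew (φ.derAdditive _) ψ.isSkew (ψ.derAdditive _) x
  have hd : ∀ {ι : Type} [Fintype ι] [DecidableEq ι] (f : (ι → ↥A) → F) (b c : ↥B) (z : ι → ↥A),
      der (bottMap A B hc) b (fun y => f y • c) z = der (bottMap A B hc) b f z • c :=
    fun f b c z => der_map _ b (LinearMap.toSpanSingleton F ↥B c).toAddMonoidHom f z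
  have hs : ∀ (k : (Fin p ⊕ Fin q → ↥A) → F) (c : ↥B) (y : Fin p ⊕ Fin q → ↥A),
      altSum k y • c = altSum (fun z => k z • c) y := by
    intro k c y
    simp only [altSum, Finset.sum_smul, smul_assoc]
  simp only [nsmul_sub, nsmul_add, ← smul_assoc, bottForm_eq_der]
  rw [factorial_smul_wK ξ.isSkew η.isSkew, factorial_smul_wK ξ.isSkew (η.isSkew.der _ _),
    factorial_smul_wK (ξ.isSkew.der _ _) η.isSkew, hs, hs, hs, ← altSum_add, ← altSum_sub]
  refine h1.trans ?_
  congr 1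
  funext z
  change lieMap B hB (ξ _ • b₁) (η _ • b₂) + der _ (ξ _ • b₁) (fun y => η y • b₂) _ -
    der _ (η _ • b₂) (fun y => ξ y • b₁) _ = _
  rw [hd, hd, AlternatingMap.der_smul_left, AlternatingMap.der_smul_left]
  simp only [map_smul, LinearMap.smul_apply, blockMul, smul_smul, smul_eq_mul]
  rw [mul_comm (η _), mul_comm (η _)]

/-- The bracket is graded antisymmetric. -/
lemma brC_swap [IsAddTorsionFree ↥B] {p q : ℕ} (φ : AlternatingMap F ↥A ↥B (Fin p))
    (ψ : AlternatingMap F ↥A ↥B (Fin q)) (x : Fin (p + q) → ↥A) :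
    brC A B hc hB p q ⇑φ ⇑ψ x =
      -((-1 : ℤ) ^ (p * q) • brC A B hc hB q p ⇑ψ ⇑φ
        (fun i => x (Fin.cast (Nat.add_comm q p) i))) := by
  refine nsmul_right_injective (factorial_mul_factorial_ne_zero p q) ?_
  simp only
  rw [smul_neg, smul_comm, mul_comm p.factorial,
    factorial_smul_brC hc hB ψ.isSkew (ψ.derAdditive _) φ.isSkew (φ.derAdditive _),
    mul_comm q.factorial,
    factorial_smul_brC hc hB φ.isSkew (φ.derAdditive _) ψ.isSkew (ψ.derAdditive _)]
  have h := altSum_reindex finSumFinEquiv (finSumFinEquiv.trans (finCongr (Nat.add_comm q p)))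
    (Equiv.sumComm (Fin q) (Fin p)) (blockBracket (bottMap A B hc) (lieMap B hB) ⇑ψ ⇑φ) x
  rw [sign_sumComm_transition] at h
  simp only [blockBracket_swap _ _ (lieMap_skew hB), altSum_neg] at h
  refine Eq.trans ?_ (congrArg (fun v => -((-1 : ℤ) ^ (p * q) • v)) h).symm
  rw [smul_smul, ← mul_pow, neg_one_mul, neg_neg, one_pow, one_smul, neg_neg]

lemma factorial_smul_brC_brC [IsAddTorsionFree ↥B] {p q t : ℕ}
    (φ : AlternatingMap F ↥A ↥B (Fin p)) (ψ : AlternatingMap F ↥A ↥B (Fin q))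
    (χ : AlternatingMap F ↥A ↥B (Fin t)) (x : Fin (p + q + t) → ↥A) :
    (p.factorial * q.factorial * t.factorial) •
        brC A B hc hB (p + q) t (brC A B hc hB p q ⇑φ ⇑ψ) ⇑χ x =
      altSum (blockBracket (bottMap A B hc) (lieMap B hB)
          (blockBracket (bottMap A B hc) (lieMap B hB) ⇑φ ⇑ψ) ⇑χ)
        (fun i => x (finSumFinSumFinEquiv p q t i)) := by
  have hpq := factorial_smul_brC hc hB φ.isSkew (φ.derAdditive _) ψ.isSkew (ψ.derAdditive _)
  have hne := factorial_mul_factorial_ne_zero p q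
  have h := factorial_smul_brC hc hB (IsSkew.of_nsmul finSumFinEquiv hne hpq)
    (DerAdditive.of_nsmul finSumFinEquiv hne hpq
      (blockBracket_derAdditive (bottMap_lieMap hc hB) φ ψ)) χ.isSkew (χ.derAdditive _) x
  have h' := altSum_absorb
    (blockBracketRight (ι := Fin (p + q)) (lieMap B hB) (χ.derAdditive (bottMap A B hc)))
    _ (blockBracket (bottMap A B hc) (lieMap B hB)
      (blockBracket (bottMap A B hc) (lieMap B hB) ⇑φ ⇑ψ) ⇑χ) finSumFinEquiv
    (Equiv.sumCongr finSumFinEquiv (Equiv.refl _)) (fun σ => Perm.sumCongr σ 1)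
    (fun σ => by simp)
    (fun σ z => blockBracket_comp_equiv _ _ (σ.trans finSumFinEquiv) (Equiv.refl _) _ _ z)
    _ _ hpq (fun i => x (finSumFinEquiv i))
  rw [Fintype.card_sum, Fintype.card_fin, Fintype.card_fin] at h'
  refine nsmul_right_injective (p + q).factorial_ne_zero (Eq.trans ?_ h')
  refine Eq.trans ?_ (congrArg _ h)
  simp only [smul_smul]
  congr 1
  ring

/-- The graded Jacobi identity. -/
lemma brC_jacobi [IsAddTorsionFree ↥B] {p q t : ℕ}
    (φ : AlternatingMap F ↥A ↥B (Fin p)) (ψ : AlternatingMap F ↥A ↥B (Fin q))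
    (χ : AlternatingMap F ↥A ↥B (Fin t)) (x : Fin (p + q + t) → ↥A)
    (h₁ : q + t + p = p + q + t) (h₂ : t + p + q = p + q + t) :
    (-1 : ℤ) ^ (p * t) • brC A B hc hB (p + q) t (brC A B hc hB p q ⇑φ ⇑ψ) ⇑χ x +
      (-1 : ℤ) ^ (q * p) • brC A B hc hB (q + t) p (brC A B hc hB q t ⇑ψ ⇑χ) ⇑φ
        (fun i => x (Fin.cast h₁ i)) +
      (-1 : ℤ) ^ (t * q) • brC A B hc hB (t + p) q (brC A B hc hB t p ⇑χ ⇑φ) ⇑ψ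
        (fun i => x (Fin.cast h₂ i)) = 0 := by
  refine nsmul_right_injective (mul_ne_zero (factorial_mul_factorial_ne_zero p q)
    t.factorial_ne_zero) ?_
  simp only [nsmul_add, smul_zero]
  rw [smul_comm, smul_comm _ ((-1 : ℤ) ^ (q * p)), smul_comm _ ((-1 : ℤ) ^ (t * q)),
    factorial_smul_brC_brC,
    show p.factorial * q.factorial * t.factorial = q.factorial * t.factorial * p.factorial by ring,
    factorial_smul_brC_brC,
    show q.factorial * t.factorial * p.factorial = t.factorial * p.factorial * q.factorial by ring,
    factorial_smul_brC_brC]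
  set β := blockBracket (ι := Fin q ⊕ Fin t) (κ := Fin p) (bottMap A B hc) (lieMap B hB)
    (blockBracket (bottMap A B hc) (lieMap B hB) ⇑ψ ⇑χ) ⇑φ
  set γ := blockBracket (ι := Fin t ⊕ Fin p) (κ := Fin q) (bottMap A B hc) (lieMap B hB)
    (blockBracket (bottMap A B hc) (lieMap B hB) ⇑χ ⇑φ) ⇑ψ
  have h1 := altSum_reindex (finSumFinSumFinEquiv p q t)
    ((finSumFinSumFinEquiv q t p).trans (finCongr h₁))
    ((Equiv.sumComm (Fin q ⊕ Fin t) (Fin p)).trans (Equiv.sumAssoc (Fin p) (Fin q) (Fin t)).symm) β x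
  have h2 := altSum_reindex (finSumFinSumFinEquiv p q t)
    ((finSumFinSumFinEquiv t p q).trans (finCongr h₂))
    ((Equiv.sumAssoc (Fin t) (Fin p) (Fin q)).trans (Equiv.sumComm (Fin t) (Fin p ⊕ Fin q))) γ x
  rw [sign_rotate_transition] at h1
  rw [sign_rotate_symm_transition] at h2
  have e1 : (-1 : ℤ) ^ (q * p) * (-1) ^ (p * (q + t)) = (-1) ^ (p * t) := by
    rw [← pow_add, show q * p + p * (q + t) = 2 * (p * q) + p * t by ring, pow_add, pow_mul]
    simp
  have e2 : (-1 : ℤ) ^ (t * q) * (-1) ^ ((p + q) * t) = (-1) ^ (p * t) := by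
    rw [← pow_add, show t * q + (p + q) * t = 2 * (q * t) + p * t by ring, pow_add, pow_mul]
    simp
  refine (congrArg₂ (fun v w => _ + (-1 : ℤ) ^ (q * p) • v + (-1 : ℤ) ^ (t * q) • w) h1 h2).trans ?_
  rw [smul_smul, e1, smul_smul, e2, ← smul_add, ← smul_add, ← altSum_add, ← altSum_add]
  simp only [β, γ, blockBracket_jacobi (lieMap_skew hB) (lieMap_jacobi hB) (bottMap_lieMap hc hB)]
  simp [altSum]

/-- The graded Leibniz rule with respect to the anchor. -/
lemma brC_wmul [IsAddTorsionFree F] [IsAddTorsionFree ↥B] {p t q : ℕ}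
    (φ : AlternatingMap F ↥A ↥B (Fin p)) (g : AlternatingMap F ↥A F (Fin t))
    (ψ : AlternatingMap F ↥A ↥B (Fin q)) (x : Fin (p + (t + q)) → ↥A)
    (h₁ : p + t + q = p + (t + q)) (h₂ : t + (p + q) = p + (t + q)) :
    brC A B hc hB p (t + q) ⇑φ (wmul t q ⇑g ⇑ψ) x =
      wmul (p + t) q (anchorAct A B hc p t ⇑φ ⇑g) ⇑ψ (fun i => x (Fin.cast h₁ i)) +
        (-1 : ℤ) ^ (p * t) • wmul t (p + q) ⇑g (brC A B hc hB p q ⇑φ ⇑ψ)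
          (fun i => x (Fin.cast h₂ i)) := by
  have hw := factorial_smul_wmul g.isSkew ψ.isSkew
  have ha := factorial_smul_anchorAct hc φ.isSkew g.isSkew (g.derAdditive _)
  have hb := factorial_smul_brC hc hB φ.isSkew (φ.derAdditive _) ψ.isSkew (ψ.derAdditive _)
  have hL : (p.factorial * t.factorial * q.factorial) •
      brC A B hc hB p (t + q) ⇑φ (wmul t q ⇑g ⇑ψ) x =
      altSum (blockBracket (bottMap A B hc) (lieMap B hB) ⇑φ (blockMul ⇑g ⇑ψ))
        (fun i => x (finSumFinSumFinEquiv' p t q i)) := by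
    have hne := factorial_mul_factorial_ne_zero t q
    have h := factorial_smul_brC hc hB φ.isSkew (φ.derAdditive _)
      (IsSkew.of_nsmul finSumFinEquiv hne hw) (DerAdditive.of_nsmul finSumFinEquiv hne hw
        ((g.derAdditive (bottMap A B hc)).blockMul (ψ.derAdditive _))) x
    have h' := altSum_absorb
      (blockBracketLeft (κ := Fin (t + q)) (lieMap B hB) (φ.derAdditive (bottMap A B hc)))
      _ (blockBracket (bottMap A B hc) (lieMap B hB) ⇑φ (blockMul ⇑g ⇑ψ)) finSumFinEquiv
      (Equiv.sumCongr (Equiv.refl _) finSumFinEquiv) (fun σ => Perm.sumCongr 1 σ)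
      (fun σ => by simp)
      (fun σ z => blockBracket_comp_equiv _ _ (Equiv.refl _) (σ.trans finSumFinEquiv) _ _ z)
      _ _ hw (fun i => x (finSumFinEquiv i))
    rw [Fintype.card_sum, Fintype.card_fin, Fintype.card_fin] at h'
    refine nsmul_right_injective (t + q).factorial_ne_zero (Eq.trans ?_ h')
    refine Eq.trans ?_ (congrArg _ h)
    simp only [smul_smul]
    congr 1
    ring
  have hM : ∀ y : Fin (p + t + q) → ↥A, (p.factorial * t.factorial * q.factorial) •
      wmul (p + t) q (anchorAct A B hc p t ⇑φ ⇑g) ⇑ψ y =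
      altSum (blockMul (blockAct (bottMap A B hc) ⇑φ ⇑g) ⇑ψ)
        (fun i => y (finSumFinSumFinEquiv p t q i)) := by
    intro y
    have hne := factorial_mul_factorial_ne_zero p t
    have h := factorial_smul_wmul (IsSkew.of_nsmul finSumFinEquiv hne ha) ψ.isSkew y
    have h' := altSum_absorb (blockMulRight (ι := Fin (p + t)) ⇑ψ)
      _ (blockMul (blockAct (bottMap A B hc) ⇑φ ⇑g) ⇑ψ) finSumFinEquiv
      (Equiv.sumCongr finSumFinEquiv (Equiv.refl _)) (fun σ => Perm.sumCongr σ 1)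
      (fun σ => by simp) (fun σ z => rfl) _ _ ha (fun i => y (finSumFinEquiv i))
    rw [Fintype.card_sum, Fintype.card_fin, Fintype.card_fin] at h'
    refine nsmul_right_injective (p + t).factorial_ne_zero (Eq.trans ?_ h')
    refine Eq.trans ?_ (congrArg _ h)
    simp only [smul_smul]
    congr 1
    ring
  have hR : ∀ y : Fin (t + (p + q)) → ↥A, (p.factorial * t.factorial * q.factorial) •
      wmul t (p + q) ⇑g (brC A B hc hB p q ⇑φ ⇑ψ) y =
      altSum (blockMul ⇑g (blockBracket (bottMap A B hc) (lieMap B hB) ⇑φ ⇑ψ))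
        (fun i => y (finSumFinSumFinEquiv' t p q i)) := by
    intro y
    have hne := factorial_mul_factorial_ne_zero p q
    have h := factorial_smul_wmul g.isSkew (IsSkew.of_nsmul finSumFinEquiv hne hb) y
    have h' := altSum_absorb (blockMulLeft (κ := Fin (p + q)) ⇑g)
      _ (blockMul ⇑g (blockBracket (bottMap A B hc) (lieMap B hB) ⇑φ ⇑ψ)) finSumFinEquiv
      (Equiv.sumCongr (Equiv.refl _) finSumFinEquiv) (fun σ => Perm.sumCongr 1 σ)
      (fun σ => by simp) (fun σ z => rfl) _ _ hb (fun i => y (finSumFinEquiv i))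
    rw [Fintype.card_sum, Fintype.card_fin, Fintype.card_fin] at h'
    refine nsmul_right_injective (p + q).factorial_ne_zero (Eq.trans ?_ h')
    refine Eq.trans ?_ (congrArg _ h)
    simp only [smul_smul]
    congr 1
    ring
  refine nsmul_right_injective (mul_ne_zero (factorial_mul_factorial_ne_zero p t)
    q.factorial_ne_zero) ?_
  simp only [nsmul_add]
  rw [smul_comm _ ((-1 : ℤ) ^ (p * t)), hL, hM, hR]
  have h1 := altSum_reindex (finSumFinSumFinEquiv' p t q)
    ((finSumFinSumFinEquiv p t q).trans (finCongr h₁)) (Equiv.sumAssoc (Fin p) (Fin t) (Fin q))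
    (blockMul (blockAct (bottMap A B hc) ⇑φ ⇑g) ⇑ψ) x
  have h2 := altSum_reindex (finSumFinSumFinEquiv' p t q)
    ((finSumFinSumFinEquiv' t p q).trans (finCongr h₂)) (sumLeftComm (Fin p) (Fin t) (Fin q))
    (blockMul ⇑g (blockBracket (bottMap A B hc) (lieMap B hB) ⇑φ ⇑ψ)) x
  rw [sign_assoc_transition, one_smul] at h1
  rw [sign_leftComm_transition] at h2
  refine Eq.trans ?_ (congrArg₂ (fun v w => v + (-1 : ℤ) ^ (p * t) • w) h1 h2).symm
  rw [smul_smul, ← mul_pow, neg_one_mul, neg_neg, one_pow, one_smul, ← altSum_add]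
  exact congrArg (fun k => altSum k _) (funext fun z => blockBracket_blockMul φ ⇑g ⇑ψ z)

end MatchedPair
/-- for a matched pair of Lie algebras `L = A ⊕ B` (complementary Lie
subalgebras), the bracket
`[ξ₁⊗b₁, ξ₂⊗b₂] = ξ₁∧ξ₂ ⊗ ⁅b₁,b₂⁆ + ξ₁∧(∇^Bott_{b₁}ξ₂) ⊗ b₂ − (∇^Bott_{b₂}ξ₁)∧ξ₂ ⊗ b₁`
together with the anchor `ρ̄(ξ⊗b)(η) = ξ ∧ ∇^Bott_b η` defines a graded Lie algebra
structure on `Λ^• A^∨ ⊗ B` over the graded commutative algebra `Λ^• A^∨`: the bracket is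
given by the displayed formula on decomposables, is graded antisymmetric, satisfies the
graded Jacobi identity, and satisfies the graded Leibniz rule with respect to `ρ̄`. -/
theorem stmt_17 (A B : Submodule K L) (hc : IsCompl A B)
    (hA : ∀ x y : L, x ∈ A → y ∈ A → ⁅x, y⁆ ∈ A)
    (hB : ∀ x y : L, x ∈ B → y ∈ B → ⁅x, y⁆ ∈ B) :
    (∀ (p q : ℕ) (ξ : AlternatingMap K ↥A K (Fin p)) (η : AlternatingMap K ↥A K (Fin q))
        (b₁ b₂ : ↥B) (x : Fin (p + q) → ↥A),
      brC A B hc hB p q (fun y => ξ y • b₁) (fun y => η y • b₂) x =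
        wK p q ⇑ξ ⇑η x • (⟨⁅(b₁ : L), (b₂ : L)⁆, hB _ _ b₁.2 b₂.2⟩ : ↥B)
          + wK p q ⇑ξ (bottForm A B hc q b₁ ⇑η) x • b₂
          - wK p q (bottForm A B hc p b₂ ⇑ξ) ⇑η x • b₁) ∧
    (∀ (p q : ℕ) (φ : AlternatingMap K ↥A ↥B (Fin p)) (ψ : AlternatingMap K ↥A ↥B (Fin q))
        (x : Fin (p + q) → ↥A),
      brC A B hc hB p q ⇑φ ⇑ψ x =
        - (((-1 : ℤ) ^ (p * q)) •
            brC A B hc hB q p ⇑ψ ⇑φ (fun i => x (Fin.cast (by omega) i)))) ∧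
    (∀ (p q t : ℕ) (φ : AlternatingMap K ↥A ↥B (Fin p))
        (ψ : AlternatingMap K ↥A ↥B (Fin q)) (χ : AlternatingMap K ↥A ↥B (Fin t))
        (x : Fin (p + q + t) → ↥A),
      ((-1 : ℤ) ^ (p * t)) •
          brC A B hc hB (p + q) t (brC A B hc hB p q ⇑φ ⇑ψ) ⇑χ
            (fun i => x (Fin.cast (by omega) i))
        + ((-1 : ℤ) ^ (q * p)) •
            brC A B hc hB (q + t) p (brC A B hc hB q t ⇑ψ ⇑χ) ⇑φ
              (fun i => x (Fin.cast (by omega) i))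
        + ((-1 : ℤ) ^ (t * q)) •
            brC A B hc hB (t + p) q (brC A B hc hB t p ⇑χ ⇑φ) ⇑ψ
              (fun i => x (Fin.cast (by omega) i)) = 0) ∧
    (∀ (p t q : ℕ) (φ : AlternatingMap K ↥A ↥B (Fin p))
        (gg : AlternatingMap K ↥A K (Fin t)) (ψ : AlternatingMap K ↥A ↥B (Fin q))
        (x : Fin (p + (t + q)) → ↥A),
      brC A B hc hB p (t + q) ⇑φ (wmul t q ⇑gg ⇑ψ) x =
        wmul (p + t) q (anchorAct A B hc p t ⇑φ ⇑gg) ⇑ψ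
            (fun i => x (Fin.cast (by omega) i))
          + ((-1 : ℤ) ^ (p * t)) •
              wmul t (p + q) ⇑gg (brC A B hc hB p q ⇑φ ⇑ψ)
                (fun i => x (Fin.cast (by omega) i))) := by
  have : IsAddTorsionFree ↥B := IsAddTorsionFree.of_isTorsionFree K ↥B
  exact ⟨fun _ _ ξ η b₁ b₂ x => brC_smul_smul hc hB ξ η b₁ b₂ x,
    fun _ _ φ ψ x => brC_swap hc hB φ ψ x,
    fun p q t φ ψ χ x => brC_jacobi hc hB φ ψ χ x (by omega) (by omega),
    fun p t q φ g ψ x => brC_wmul hc hB φ g ψ x (by omega) (by omega)⟩
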